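/- arXiv:2202.07626 — 3 statements merged into one kernel-verified Lean document; each statement's English description precedes it below -/
import Mathlib

section
/- Let J ⊂ [m] and J^c = [m] \ J. Suppose W ∈ ℝ^{m×d} satisfies ‖W‖_F ≤ 1 and there is a constant C_f > 1 such that y·f^J(x;W) ≥ 1/C_f for some (x,y) ∈ ℝ^d × {±1}. If ‖x‖ ≤ 2 and |J^c|/m ≤ 1/(16C_f²), then y·f(x;W) ≥ 1/(2C_f). -/
open scoped RealInnerProductSpace BigOperators
noncomputable section

/-- The ReLU activation. -/
def relu (t : ℝ) : ℝ := max t 0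

/-- Two-layer ReLU network with first-layer rows `W` and second-layer weights `a`. -/
def net {d m : ℕ} (a : Fin m → ℝ) (W : Fin m → EuclideanSpace ℝ (Fin d))
    (x : EuclideanSpace ℝ (Fin d)) : ℝ :=
  ∑ j, a j * relu ⟪W j, x⟫

/-- Subnetwork over the neuron index set `J`. -/
def netOn {d m : ℕ} (J : Finset (Fin m)) (a : Fin m → ℝ)
    (W : Fin m → EuclideanSpace ℝ (Fin d)) (x : EuclideanSpace ℝ (Fin d)) : ℝ :=
  ∑ j ∈ J, a j * relu ⟪W j, x⟫

/-- Frobenius norm of the weight matrix with rows `W`. -/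
def frob {d m : ℕ} (W : Fin m → EuclideanSpace ℝ (Fin d)) : ℝ :=
  Real.sqrt (∑ j, ‖W j‖ ^ 2)

/-- Let `J ⊂ [m]` and `J^c = [m] \ J`.  Suppose `‖W‖_F ≤ 1` and there is a constant
`C_f > 1` such that `y·f^J(x;W) ≥ 1/C_f` for some `(x,y) ∈ ℝ^d × {±1}`.  If `‖x‖ ≤ 2` and
`|J^c|/m ≤ 1/(16 C_f²)`, then `y·f(x;W) ≥ 1/(2 C_f)`.  Here the second-layer weights are fixed
with `a_j ∈ {+1/√m, −1/√m}`. -/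
theorem statement6 {d m : ℕ} (a : Fin m → ℝ)
    (ha : ∀ j, a j = 1 / Real.sqrt m ∨ a j = -(1 / Real.sqrt m))
    (J : Finset (Fin m)) (W : Fin m → EuclideanSpace ℝ (Fin d))
    (hWF : frob W ≤ 1)
    (Cf : ℝ) (hCf : 1 < Cf)
    (x : EuclideanSpace ℝ (Fin d)) (y : ℝ) (hy : y = 1 ∨ y = -1)
    (hmargin : 1 / Cf ≤ y * netOn J a W x)
    (hx : ‖x‖ ≤ 2)
    (hJc : ((Jᶜ.card : ℝ) / m) ≤ 1 / (16 * Cf ^ 2)) :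
    1 / (2 * Cf) ≤ y * net a W x := by
  have hsplit : net a W x = netOn J a W x + netOn Jᶜ a W x := by
    unfold net netOn
    exact (Finset.sum_add_sum_compl J _).symm
  have hC : 0 < Cf := by linarith
  have hW2 : ∑ j, ‖W j‖ ^ 2 ≤ 1 := by
    unfold frob at hWF
    have := (Real.sqrt_le_left (by norm_num : (0:ℝ) ≤ 1)).1 hWF
    simpa using this
  have hcs : (netOn Jᶜ a W x) ^ 2 ≤
      (∑ j ∈ Jᶜ, a j ^ 2) * ∑ j ∈ Jᶜ, (relu ⟪W j, x⟫) ^ 2 := by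
    unfold netOn
    exact Finset.sum_mul_sq_le_sq_mul_sq _ _ _
  have ha2 : ∑ j ∈ Jᶜ, a j ^ 2 = (Jᶜ.card : ℝ) / m := by
    have h : ∀ j ∈ Jᶜ, a j ^ 2 = 1 / (m : ℝ) := by
      intro j _
      have hm : Real.sqrt m ^ 2 = m := Real.sq_sqrt (Nat.cast_nonneg m)
      rcases ha j with h | h <;> rw [h] <;> simp [hm]
    rw [Finset.sum_congr rfl h]
    simp [div_eq_mul_inv]
  have hr : ∑ j ∈ Jᶜ, (relu ⟪W j, x⟫) ^ 2 ≤ 4 := by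
    have h1 : ∀ j, (relu ⟪W j, x⟫) ^ 2 ≤ 4 * ‖W j‖ ^ 2 := by
      intro j
      have h0 : 0 ≤ relu ⟪W j, x⟫ := le_max_right _ _
      have h2 : relu ⟪W j, x⟫ ≤ ‖W j‖ * 2 := by
        refine max_le ((real_inner_le_norm _ _).trans ?_) (by positivity)
        gcongr
      nlinarith [norm_nonneg (W j)]
    calc _ ≤ ∑ j ∈ Jᶜ, 4 * ‖W j‖ ^ 2 := Finset.sum_le_sum fun j _ => h1 j
      _ ≤ ∑ j, 4 * ‖W j‖ ^ 2 :=
        Finset.sum_le_sum_of_subset_of_nonneg (Finset.subset_univ _) fun _ _ _ => by positivity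
      _ = 4 * ∑ j, ‖W j‖ ^ 2 := by rw [Finset.mul_sum]
      _ ≤ 4 := by linarith
  have hS : (netOn Jᶜ a W x) ^ 2 ≤ (1 / (2 * Cf)) ^ 2 := by
    rw [ha2] at hcs
    calc _ ≤ _ := hcs
      _ ≤ 1 / (16 * Cf ^ 2) * 4 :=
        mul_le_mul hJc hr (Finset.sum_nonneg fun _ _ => sq_nonneg _) (by positivity)
      _ = _ := by field_simp; norm_num
  have hab := abs_le.1 (abs_le_of_sq_le_sq hS (by positivity))
  have hhalf : 1 / Cf = 1 / (2 * Cf) + 1 / (2 * Cf) := by field_simp; norm_num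
  rw [hsplit, mul_add]
  rcases hy with h | h <;> subst h <;> linarith [hab.1, hab.2]
end
end

section
/- Let J = J_{±μ₁} ∪ J_{±μ₂} be the candidate neuron sets from the candidate-subnetwork lemma. Suppose the neuron alignment condition and the almost-orthogonality condition hold at times τ = 1, …, T−1 = 1/(4α). Then on a good run, for all sufficiently large C > 1, at time T = 1 + 1/(4α) the gradient descent iterate satisfies ‖W^{(T)}‖_F ≤ 1, and y_i·f^J(x_i; W^{(T)}) ≥ 1/C₃ > 0 for all clean indices i ∈ 𝒞, while y_i·f^J(x_i; W^{(T)}) ≤ −1/C₃ < 0 for all noisy indices i ∈ 𝒩, where C₃ = 4096·e²/(1 − 1/C₀)² and C₀ > 1 is the constant of the candidate-subnetwork lemma. -/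
open scoped RealInnerProductSpace BigOperators
open Finset
noncomputable section

/-- `D` is a valid choice of subgradient for the ReLU. -/
def IsReluDeriv (D : ℝ → ℝ) : Prop :=
  (∀ t, 0 < t → D t = 1) ∧ (∀ t, t < 0 → D t = 0) ∧ D 0 ∈ Set.Icc (0:ℝ) 1

/-- One step of gradient descent with step size `α` on the logistic empirical risk. -/
def gdStep {d m n : ℕ} (a : Fin m → ℝ) (D : ℝ → ℝ) (α : ℝ)
    (x : Fin n → EuclideanSpace ℝ (Fin d)) (y : Fin n → ℝ)
    (W W' : Fin m → EuclideanSpace ℝ (Fin d)) : Prop :=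
  ∀ j, W' j = W j + (α * a j / n) •
    ∑ i, ((1 / (1 + Real.exp (y i * net a W (x i)))) * y i * D ⟪W j, x i⟫) • x i

/-- The four cluster means `+μ₁, −μ₁, +μ₂, −μ₂`. -/
def ms {d : ℕ} (μ₁ μ₂ : EuclideanSpace ℝ (Fin d)) : Fin 4 → EuclideanSpace ℝ (Fin d) :=
  ![μ₁, -μ₁, μ₂, -μ₂]

/-- The index of the opposing cluster. -/
def opp : Fin 4 → Fin 4 := ![1, 0, 3, 2]

/-- The clean labels of the four clusters. -/
def ls : Fin 4 → ℝ := ![1, 1, -1, -1]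

/-- The candidate neuron set `J_μ` for the `k`-th cluster: neurons of the matching second-layer
sign (positive for `±μ₁`, negative for `±μ₂`) whose normalized correlation with the cluster
mean at initialization is at least `1/(3C₀√d)`. -/
def Jset {d m : ℕ} (a : Fin m → ℝ) (W0 : Fin m → EuclideanSpace ℝ (Fin d)) (C₀ : ℝ)
    (μ₁ μ₂ : EuclideanSpace ℝ (Fin d)) (k : Fin 4) : Finset (Fin m) :=
  univ.filter (fun j =>
    (if (k : ℕ) < 2 then 0 < a j else a j < 0) ∧
    1/(3*C₀*Real.sqrt d) ≤ ⟪‖W0 j‖⁻¹ • W0 j, ms μ₁ μ₂ k⟫)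

/-- The union of the four candidate neuron sets. -/
def JsetAll {d m : ℕ} (a : Fin m → ℝ) (W0 : Fin m → EuclideanSpace ℝ (Fin d)) (C₀ : ℝ)
    (μ₁ μ₂ : EuclideanSpace ℝ (Fin d)) : Finset (Fin m) :=
  Jset a W0 C₀ μ₁ μ₂ 0 ∪ Jset a W0 C₀ μ₁ μ₂ 1 ∪ Jset a W0 C₀ μ₁ μ₂ 2 ∪ Jset a W0 C₀ μ₁ μ₂ 3

/-- The absolute constant `C₀` fixed in the definition of a good run. -/
def C₀val : ℝ := 4^5 * 1024^2 * Real.exp 4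

/-- Neuron alignment condition at a weight configuration `W`: for every cluster `k` and every
candidate neuron `j ∈ J_μ`, the neuron is active on every sample of cluster `k` and inactive on
every sample of the opposing cluster. -/
def NAC {d m n : ℕ} (a : Fin m → ℝ) (W0 : Fin m → EuclideanSpace ℝ (Fin d)) (C₀ : ℝ)
    (μ₁ μ₂ : EuclideanSpace ℝ (Fin d)) (x : Fin n → EuclideanSpace ℝ (Fin d))
    (c : Fin n → Fin 4) (D : ℝ → ℝ) (W : Fin m → EuclideanSpace ℝ (Fin d)) : Prop :=
  ∀ k : Fin 4, ∀ j ∈ Jset a W0 C₀ μ₁ μ₂ k,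
    (∀ i, c i = k → D ⟪W j, x i⟫ = 1) ∧ (∀ i, c i = opp k → D ⟪W j, x i⟫ = 0)

/-- Almost-orthogonality at a weight configuration `W`. -/
def AO {d m : ℕ} (a : Fin m → ℝ) (W0 : Fin m → EuclideanSpace ℝ (Fin d)) (C₀ : ℝ)
    (μ₁ μ₂ : EuclideanSpace ℝ (Fin d)) (α : ℝ)
    (W : Fin m → EuclideanSpace ℝ (Fin d)) : Prop :=
  (∀ j ∈ Jset a W0 C₀ μ₁ μ₂ 0 ∪ Jset a W0 C₀ μ₁ μ₂ 1, |⟪W j, μ₂⟫| ≤ 3 * α * |a j|) ∧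
  (∀ j ∈ Jset a W0 C₀ μ₁ μ₂ 2 ∪ Jset a W0 C₀ μ₁ μ₂ 3, |⟪W j, μ₁⟫| ≤ 3 * α * |a j|)

/-- Assumptions (A1)-(A7). -/
def Assum (C : ℝ) (d m n : ℕ) (δ σ η ωinit α : ℝ) : Prop :=
  C * max ((Real.log (n/δ))^2) (Real.log (m/δ)) ≤ (d : ℝ) ∧
  σ^2 ≤ 1/(C^2 * d) ∧
  C * Real.log (m/δ) ≤ (n : ℝ) ∧
  η ≤ 1/C ∧
  C * Real.log (1/δ) ≤ (m : ℝ) ∧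
  (0 < ωinit^2 ∧ ωinit^2 ≤ 1/(C^4 * m * d)) ∧
  (1/(2*Real.sqrt C) ≤ α ∧ α ≤ 1/Real.sqrt C)

/-- A good run: the conclusions of the random-initialization lemma, the candidate-subnetwork
lemma (with `C₀ = C₀val`), the sample-properties lemma (with its constant `C₁`), and the
activation-count lemma (with its constant `C₂`), all for the realized initialization `W0` and
the realized training data `(x_i, c_i, y_i)`. -/
def GoodRun {d m n : ℕ} (a : Fin m → ℝ) (W0 : Fin m → EuclideanSpace ℝ (Fin d))
    (C₁ C₂ σ δ η ωinit : ℝ) (μ₁ μ₂ : EuclideanSpace ℝ (Fin d))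
    (x : Fin n → EuclideanSpace ℝ (Fin d)) (c : Fin n → Fin 4) (y : Fin n → ℝ)
    (D : ℝ → ℝ) : Prop :=
  -- random-initialization lemma: norms of the rows at initialization
  (∀ j, (1/2) * (ωinit * Real.sqrt d) ≤ ‖W0 j‖ ∧ ‖W0 j‖ ≤ (3/2) * (ωinit * Real.sqrt d)) ∧
  -- random-initialization lemma: neuron counting at each cluster mean
  (∀ k : Fin 4, (m : ℝ) * (1 - 1/(2*C₀val) - Real.sqrt (2 * Real.log (4/δ) / m)) ≤
    ((univ.filter (fun j : Fin m => ωinit/(2*C₀val) ≤ |⟪W0 j, ms μ₁ μ₂ k⟫|)).card : ℝ)) ∧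
  -- candidate-subnetwork lemma
  (∀ k : Fin 4, (m : ℝ)/4 * (1 - 1/C₀val)^2 ≤ ((Jset a W0 C₀val μ₁ μ₂ k).card : ℝ)) ∧
  -- sample-properties lemma, part (a)
  (∀ k : Fin 4, ∀ i, c i = k →
    (1 - C₁ * σ * Real.sqrt d ≤ ⟪x i, ms μ₁ μ₂ k⟫) ∧
    (∀ v : EuclideanSpace ℝ (Fin d), ‖v‖ = 1 → ⟪v, ms μ₁ μ₂ k⟫ = 0 →
      |⟪x i, v⟫| ≤ C₁ * σ * Real.sqrt d)) ∧
  (C₁ * σ * Real.sqrt d ≤ 1/C₁) ∧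
  -- sample-properties lemma, part (b)
  (∀ k : Fin 4, ∀ i, c i = k → ‖x i - ms μ₁ μ₂ k‖^2 ≤ C₁ * σ^2 * d) ∧
  (C₁ * σ^2 * (d:ℝ) ≤ 1/C₁) ∧
  -- sample-properties lemma, part (c): the fraction of noisy points
  (((univ.filter (fun i : Fin n => y i ≠ ls (c i))).card : ℝ) / n ≤
    η + C₁ * Real.sqrt (Real.log (1/δ) / n)) ∧
  (η + C₁ * Real.sqrt (Real.log (1/δ) / n) ≤ η + 1/C₁) ∧
  -- sample-properties lemma, part (d): cluster counts
  (∀ k : Fin 4,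
    1/4 - C₁ * Real.sqrt (Real.log (1/δ) / n) ≤
      ((univ.filter (fun i : Fin n => c i = k)).card : ℝ) / n ∧
    ((univ.filter (fun i : Fin n => c i = k)).card : ℝ) / n ≤
      1/4 + C₁ * Real.sqrt (Real.log (1/δ) / n)) ∧
  -- activation-count lemma
  (∀ k : Fin 4, ∀ j : Fin m,
    1/(3*C₀val*Real.sqrt d) ≤ ⟪‖W0 j‖⁻¹ • W0 j, ms μ₁ μ₂ k⟫ →
    (n : ℝ)/C₂ ≤
      (∑ i ∈ univ.filter (fun i : Fin n => c i = k ∧ y i = ls (c i)), D ⟪W0 j, x i⟫) -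
      (∑ i ∈ univ.filter (fun i : Fin n => c i = opp k ∧ y i = ls (c i)), D ⟪W0 j, x i⟫))

/-- The constant `C₃` of the subnetwork-margin lemma. -/
def C₃val : ℝ := 4096 * Real.exp 2 / (1 - 1/C₀val)^2

set_option maxHeartbeats 4000000

lemma le_of_sq_aux {p q : ℝ} (h : p^2 ≤ q^2) (hq : 0 ≤ q) : p ≤ q :=
  abs_le_of_sq_le_sq' h hq |>.2

lemma neg_of_ne_aux {u v : ℝ} (hu : u = 1 ∨ u = -1) (hv : v = 1 ∨ v = -1) (h : u ≠ v) :
    u = -v := by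
  rcases hu with rfl | rfl <;> rcases hv with rfl | rfl <;> simp_all

lemma C₀val_q : 1/2 ≤ (1 - 1/C₀val)^2 ∧ (1 - 1/C₀val)^2 ≤ 1 := by
  have h3 : 4 ≤ C₀val := by
    unfold C₀val
    have := Real.one_le_exp (by norm_num : (0:ℝ) ≤ 4)
    norm_num
    linarith
  have h4 : 1/C₀val ≤ 1/4 := one_div_le_one_div_of_le (by norm_num) h3
  have h5 : 0 < 1/C₀val := by positivity
  constructor <;> nlinarith

lemma reluDeriv_mem {D : ℝ → ℝ} (hD : IsReluDeriv D) (t : ℝ) : 0 ≤ D t ∧ D t ≤ 1 := by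
  obtain ⟨h1, h2, h3⟩ := hD
  rcases lt_trichotomy t 0 with h | h | h
  · rw [h2 t h]; norm_num
  · rw [h]; exact h3
  · rw [h1 t h]; norm_num

lemma step_norm {d m n : ℕ} {a : Fin m → ℝ} {D : ℝ → ℝ} {α : ℝ}
    {x : Fin n → EuclideanSpace ℝ (Fin d)} {y : Fin n → ℝ}
    {W W' : Fin m → EuclideanSpace ℝ (Fin d)} (h : gdStep a D α x y W W')
    (hn : 1 ≤ n) (hα : 0 < α) (hD : IsReluDeriv D) (hy : ∀ i, y i = 1 ∨ y i = -1)
    {R : ℝ} (hx : ∀ i, ‖x i‖ ≤ R) (j : Fin m) : ‖W' j - W j‖ ≤ α * |a j| * R := by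
  have hn' : (0:ℝ) < n := by exact_mod_cast hn
  rw [h j, add_sub_cancel_left, norm_smul]
  have hs : ‖∑ i, ((1 / (1 + Real.exp (y i * net a W (x i)))) * y i * D ⟪W j, x i⟫) • x i‖
      ≤ n * R := by
    refine (norm_sum_le _ _).trans ?_
    have : ∀ i ∈ (univ : Finset (Fin n)),
        ‖((1 / (1 + Real.exp (y i * net a W (x i)))) * y i * D ⟪W j, x i⟫) • x i‖ ≤ R := by
      intro i _
      rw [norm_smul, Real.norm_eq_abs, abs_mul, abs_mul]
      have h1 : |y i| = 1 := by rcases hy i with h | h <;> simp [h]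
      have he := Real.exp_pos (y i * net a W (x i))
      have h2 : |1 / (1 + Real.exp (y i * net a W (x i)))| ≤ 1 := by
        rw [abs_of_pos (by positivity), div_le_one (by positivity)]; linarith
      have h3 : |D ⟪W j, x i⟫| ≤ 1 := by
        obtain ⟨p, q⟩ := reluDeriv_mem hD ⟪W j, x i⟫
        rw [abs_of_nonneg p]; exact q
      rw [h1, mul_one]
      have h4 : |1 / (1 + Real.exp (y i * net a W (x i)))| * |D ⟪W j, x i⟫| ≤ 1 :=
        mul_le_one₀ h2 (abs_nonneg _) h3
      calc _ ≤ 1 * ‖x i‖ := mul_le_mul_of_nonneg_right h4 (norm_nonneg _)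
        _ ≤ R := by rw [one_mul]; exact hx i
    refine (Finset.sum_le_sum this).trans ?_
    simp
  rw [Real.norm_eq_abs, abs_div, abs_mul, abs_of_pos hα, abs_of_pos hn']
  calc α * |a j| / n * _ ≤ α * |a j| / n * (n * R) :=
        mul_le_mul_of_nonneg_left hs (by positivity)
    _ = α * |a j| * R := by field_simp

lemma net_abs {d m : ℕ} {a : Fin m → ℝ} {W : Fin m → EuclideanSpace ℝ (Fin d)}
    {x : EuclideanSpace ℝ (Fin d)} {b r R : ℝ} (hb : 0 ≤ b) (hr : 0 ≤ r)
    (ha : ∀ j, |a j| = b) (hW : ∀ j, ‖W j‖ ≤ r) (hx : ‖x‖ ≤ R) :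
    |net a W x| ≤ m * (b * (r * R)) := by
  unfold net
  refine (Finset.abs_sum_le_sum_abs _ _).trans ?_
  have : ∀ j ∈ (univ : Finset (Fin m)), |a j * relu ⟪W j, x⟫| ≤ b * (r * R) := by
    intro j _
    rw [abs_mul, ha j]
    refine mul_le_mul_of_nonneg_left ?_ hb
    have h1 : |relu ⟪W j, x⟫| ≤ |⟪W j, x⟫| := by
      unfold relu
      rw [abs_of_nonneg (le_max_right _ _)]
      exact max_le (le_abs_self _) (abs_nonneg _)
    refine h1.trans ((abs_real_inner_le_norm _ _).trans ?_)
    exact mul_le_mul (hW j) hx (norm_nonneg _) hr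
  refine (Finset.sum_le_sum this).trans ?_
  simp

lemma ms_norm {d : ℕ} {μ₁ μ₂ : EuclideanSpace ℝ (Fin d)} (h1 : ‖μ₁‖ = 1) (h2 : ‖μ₂‖ = 1)
    (k : Fin 4) : ‖ms μ₁ μ₂ k‖ = 1 := by
  fin_cases k <;> simp [ms, h1, h2]

lemma ms_orth {d : ℕ} {μ₁ μ₂ : EuclideanSpace ℝ (Fin d)} (h : ⟪μ₁, μ₂⟫ = 0)
    (k l : Fin 4) (hkl : l ≠ k) (hkl' : l ≠ opp k) : ⟪ms μ₁ μ₂ l, ms μ₁ μ₂ k⟫ = 0 := by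
  have h' : ⟪μ₂, μ₁⟫ = 0 := by rw [real_inner_comm]; exact h
  fin_cases k <;> fin_cases l <;> simp_all [ms, opp]

lemma ls_sq (k : Fin 4) : ls k = 1 ∨ ls k = -1 := by
  fin_cases k <;> simp [ls]

lemma Jset_sign {d m : ℕ} {a : Fin m → ℝ} {W0 : Fin m → EuclideanSpace ℝ (Fin d)} {C₀ : ℝ}
    {μ₁ μ₂ : EuclideanSpace ℝ (Fin d)} {k : Fin 4} {j : Fin m}
    (hj : j ∈ Jset a W0 C₀ μ₁ μ₂ k) : 0 < ls k * a j := by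
  simp only [Jset, mem_filter] at hj
  obtain ⟨-, h, -⟩ := hj
  fin_cases k <;> simp_all [ls]

/-- Numerical core. -/
lemma core {d m n : ℕ} {δ' α b : ℝ} {μ₁ μ₂ : EuclideanSpace ℝ (Fin d)}
    {a : Fin m → ℝ} {D : ℝ → ℝ}
    {x : Fin n → EuclideanSpace ℝ (Fin d)} {c : Fin n → Fin 4} {y : Fin n → ℝ}
    {W : ℕ → Fin m → EuclideanSpace ℝ (Fin d)} {T : ℕ} {C₀ : ℝ}
    (hδ : δ' = 1/10000)
    (hn : 1 ≤ n) (hb : 0 < b) (hmb : m * (b * b) = 1)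
    (h1 : ‖μ₁‖ = 1) (h2 : ‖μ₂‖ = 1) (h12 : ⟪μ₁, μ₂⟫ = 0)
    (ha : ∀ j, |a j| = b) (hD : IsReluDeriv D) (hy : ∀ i, y i = 1 ∨ y i = -1)
    (hgd : ∀ t, gdStep a D α x y (W t) (W (t+1)))
    (hα : 0 < α) (hαδ : α ≤ δ') (hT : (T : ℝ) = 1 + 1/(4*α))
    (hW0 : ∀ j, ‖W 0 j‖ ≤ δ' * b)
    (hx : ∀ i, ‖x i - ms μ₁ μ₂ (c i)‖ ≤ δ')
    (hnoise : ((univ.filter (fun i : Fin n => y i ≠ ls (c i))).card : ℝ) ≤ 2 * δ' * n)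
    (hcl : ∀ k, (1/4 - δ') * n ≤ ((univ.filter (fun i : Fin n => c i = k)).card : ℝ))
    (hNA : ∀ τ : ℕ, 1 ≤ τ → τ ≤ T - 1 →
        NAC a (W 0) C₀ μ₁ μ₂ x c D (W τ) ∧ AO a (W 0) C₀ μ₁ μ₂ α (W τ)) :
    frob (W T) ≤ 1 ∧ ∀ i, (13/1000) * (b*b) * ((Jset a (W 0) C₀ μ₁ μ₂ (c i)).card : ℝ) - 5 * δ'
      ≤ ls (c i) * netOn (JsetAll a (W 0) C₀ μ₁ μ₂) a (W T) (x i) := by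
  have hn' : (0:ℝ) < n := by exact_mod_cast hn
  have hδ0 : 0 < δ' := by rw [hδ]; norm_num
  have hxn : ∀ i, ‖x i‖ ≤ 1 + δ' := by
    intro i
    have := norm_le_norm_add_norm_sub' (x i) (ms μ₁ μ₂ (c i))
    rw [ms_norm h1 h2] at this
    linarith [hx i]
  have hstep : ∀ t j, ‖W (t+1) j - W t j‖ ≤ α * b * (1 + δ') := by
    intro t j
    have := step_norm (hgd t) hn hα hD hy hxn j
    rwa [ha j] at this
  have hWt : ∀ t : ℕ, ∀ j, ‖W t j‖ ≤ b * (δ' + t * α * (1 + δ')) := by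
    intro t j
    induction t with
    | zero => simpa [mul_comm] using hW0 j
    | succ t ih =>
      have := norm_le_norm_add_norm_sub' (W (t+1) j) (W t j)
      have h3 := hstep t j
      push_cast
      nlinarith
  have hTα : T * α = α + 1/4 := by rw [hT]; field_simp
  have hWT : ∀ t : ℕ, t ≤ T → ∀ j, ‖W t j‖ ≤ b * (26/100) := by
    intro t ht j
    refine (hWt t j).trans (mul_le_mul_of_nonneg_left ?_ hb.le)
    have h3 : (t:ℝ) * α ≤ T * α := mul_le_mul_of_nonneg_right (by exact_mod_cast ht) hα.le
    have h4 : (t:ℝ) * α ≤ δ' + 1/4 := by linarith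
    have h5 := mul_le_mul_of_nonneg_right h4 (by linarith : 0 ≤ 1 + δ')
    rw [hδ] at h5 ⊢
    linarith
  have hT2 : 2 ≤ T := by
    have : (2:ℝ) ≤ T := by
      rw [hT]
      have : 1 ≤ 1/(4*α) := by rw [le_div_iff₀ (by positivity)]; rw [hδ] at hαδ; linarith
      linarith
    exact_mod_cast this
  obtain ⟨S, rfl⟩ : ∃ S, T = S + 1 := ⟨T - 1, by omega⟩
  have hSα : S * α = 1/4 := by push_cast at hTα; linarith
  constructor
  · unfold frob
    rw [Real.sqrt_le_left (by norm_num), one_pow]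
    have : ∀ j ∈ (univ : Finset (Fin m)), ‖W (S+1) j‖^2 ≤ b * b := by
      intro j _
      have := hWT (S+1) le_rfl j
      have h0 := norm_nonneg (W (S+1) j)
      nlinarith
    refine (Finset.sum_le_sum this).trans ?_
    simp [hmb]
  -- gradient weights
  have hg : ∀ t ≤ S + 1, ∀ i, 1/4 ≤ 1 / (1 + Real.exp (y i * net a (W t) (x i))) ∧
      1 / (1 + Real.exp (y i * net a (W t) (x i))) ≤ 1 := by
    intro t ht i
    have h3 := net_abs hb.le (by positivity : 0 ≤ b * (26/100)) ha (hWT t ht) (hxn i)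
    have h4 : |net a (W t) (x i)| ≤ 1 := by
      refine h3.trans ?_
      have : (m:ℝ) * (b * (b * (26/100) * (1 + δ'))) = (m * (b*b)) * ((26/100) * (1+δ')) := by ring
      rw [this, hmb, hδ]; norm_num
    have h5 : y i * net a (W t) (x i) ≤ 1 := by
      rw [abs_le] at h4
      rcases hy i with h | h <;> rw [h] <;> linarith
    have h6 := Real.exp_le_exp.mpr h5
    have h7 := Real.exp_one_lt_d9
    have h8 := Real.exp_pos (y i * net a (W t) (x i))
    constructor
    · apply one_div_le_one_div_of_le <;> linarith
    · rw [div_le_one] <;> linarith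
  -- growth
  have hinner : ∀ i, ∀ v : EuclideanSpace ℝ (Fin d), ‖v‖ = 1 →
      |⟪x i, v⟫ - ⟪ms μ₁ μ₂ (c i), v⟫| ≤ δ' := by
    intro i v hv
    rw [← inner_sub_left]
    refine (abs_real_inner_le_norm _ _).trans ?_
    rw [hv, mul_one]; exact hx i
  have hgrow : ∀ k, ∀ j ∈ Jset a (W 0) C₀ μ₁ μ₂ k, ∀ t, 1 ≤ t → t ≤ S →
      ⟪W t j, ms μ₁ μ₂ k⟫ + α * b * (6/100) ≤ ⟪W (t+1) j, ms μ₁ μ₂ k⟫ := by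
    intro k j hj t ht1 htS
    obtain ⟨hN, -⟩ := hNA t ht1 (by omega)
    obtain ⟨hN1, hN2⟩ := hN k j hj
    have hsa : a j = b * ls k := by
      have h3 := Jset_sign hj
      have h4 := ha j
      rcases ls_sq k with h | h <;> rw [h] at h3 ⊢
      · rw [abs_of_pos (by linarith)] at h4; linarith
      · rw [abs_of_neg (by linarith)] at h4; linarith
    rw [hgd t j, inner_add_left, inner_smul_left, sum_inner]
    simp only [inner_smul_left, RCLike.conj_to_real]
    have hterm : ∀ i ∈ (univ : Finset (Fin n)),
        (1/4) * (1 - δ') * (if c i = k then 1 else 0) - 2 * (if y i ≠ ls (c i) then 1 else 0) - δ'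
        ≤ ls k * (1 / (1 + Real.exp (y i * net a (W t) (x i))) * y i * D ⟪W t j, x i⟫ *
          ⟪x i, ms μ₁ μ₂ k⟫) := by
      intro i _
      obtain ⟨g1, g2⟩ := hg t (by omega) i
      set g := 1 / (1 + Real.exp (y i * net a (W t) (x i))) with hgdef
      have hin := abs_le.mp (hinner i (ms μ₁ μ₂ k) (ms_norm h1 h2 k))
      obtain ⟨d1, d2⟩ := reluDeriv_mem hD ⟪W t j, x i⟫
      by_cases hk : c i = k
      · rw [hN1 i hk, mul_one]
        rw [hk, real_inner_self_eq_norm_sq, ms_norm h1 h2 k] at hin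
        generalize ⟪x i, ms μ₁ μ₂ k⟫ = p at hin ⊢
        rw [if_pos hk, hk]
        by_cases hc : y i = ls k
        · rw [hc]
          have : ls k * (g * ls k * p) = g * p := by
            rcases ls_sq k with h | h <;> rw [h] <;> ring
          rw [this]
          simp only [ne_eq, not_true_eq_false, if_false]
          have : 0 ≤ p := by linarith [hδ]
          nlinarith
        · have hyk : y i = - ls k := neg_of_ne_aux (hy i) (ls_sq k) hc
          simp only [ne_eq, hc, not_false_eq_true, if_true]
          rw [hyk]
          have : ls k * (g * -ls k * p) = - (g * p) := by
            rcases ls_sq k with h | h <;> rw [h] <;> ring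
          rw [this]
          have : 0 ≤ p := by linarith [hδ]
          nlinarith
      · rw [if_neg hk]
        have hz : (0:ℝ) ≤ 2 * (if y i ≠ ls (c i) then 1 else 0) := by split_ifs <;> norm_num
        by_cases hk' : c i = opp k
        · rw [hN2 i hk']; simp only [mul_zero, zero_mul]; linarith
        · rw [ms_orth h12 k (c i) hk hk'] at hin
          have hp : |⟪x i, ms μ₁ μ₂ k⟫| ≤ δ' := abs_le.mpr ⟨by linarith, by linarith⟩
          generalize ⟪x i, ms μ₁ μ₂ k⟫ = p at hp ⊢
          have hq : |ls k * (g * y i * D ⟪W t j, x i⟫ * p)| ≤ δ' := by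
            have e1 : |ls k| = 1 := by rcases ls_sq k with h | h <;> simp [h]
            have e2 : |y i| = 1 := by rcases hy i with h | h <;> simp [h]
            rw [abs_mul, abs_mul, abs_mul, abs_mul, e1, e2, abs_of_nonneg d1,
              abs_of_nonneg (by linarith : 0 ≤ g)]
            have : g * D ⟪W t j, x i⟫ ≤ 1 := mul_le_one₀ g2 d1 d2
            nlinarith [abs_nonneg p]
          linarith [(abs_le.mp hq).1]
    have hsum := Finset.sum_le_sum hterm
    rw [← Finset.mul_sum] at hsum
    simp only [Finset.sum_sub_distrib, ← Finset.mul_sum, Finset.sum_boole, Finset.sum_const,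
      Finset.card_univ, Fintype.card_fin, nsmul_eq_mul] at hsum
    have hlow : (6/100) * (n:ℝ) ≤ ls k * ∑ i, (1 / (1 + Real.exp (y i * net a (W t) (x i))) * y i *
        D ⟪W t j, x i⟫ * ⟪x i, ms μ₁ μ₂ k⟫) := by
      refine le_trans ?_ hsum
      have h3 := hcl k
      have h4 := hnoise
      rw [hδ] at h3 h4 ⊢
      linarith
    generalize (∑ i, (1 / (1 + Real.exp (y i * net a (W t) (x i))) * y i *
        D ⟪W t j, x i⟫ * ⟪x i, ms μ₁ μ₂ k⟫)) = s at hlow ⊢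
    have : α * a j / n * s = α * b * ((ls k * s) / n) := by rw [hsa]; ring
    rw [this]
    have h6 : 6/100 ≤ ls k * s / n := by rw [le_div_iff₀ hn']; exact hlow
    have := mul_le_mul_of_nonneg_left h6 (by positivity : 0 ≤ α * b)
    linarith
  have hgrow' : ∀ k, ∀ j ∈ Jset a (W 0) C₀ μ₁ μ₂ k, ∀ t, t ≤ S →
      ⟪W 1 j, ms μ₁ μ₂ k⟫ + t * (α * b * (6/100)) ≤ ⟪W (t+1) j, ms μ₁ μ₂ k⟫ := by
    intro k j hj t
    induction t with
    | zero => intro _; simp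
    | succ t ih =>
      intro ht
      have h3 := ih (by omega)
      have h4 := hgrow k j hj (t+1) (by omega) ht
      push_cast
      linarith
  have hpos : ∀ i, ∀ j ∈ Jset a (W 0) C₀ μ₁ μ₂ (c i), (13/1000) * b ≤ ⟪W (S+1) j, x i⟫ := by
    intro i j hj
    have h3 := hgrow' (c i) j hj S le_rfl
    have h4 : (S:ℝ) * (α * b * (6/100)) = (S * α) * (b * (6/100)) := by ring
    rw [h4, hSα] at h3
    have h5 := hWt 1 j
    have h6 := (abs_le.mp (abs_real_inner_le_norm (W 1 j) (ms μ₁ μ₂ (c i)))).1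
    rw [ms_norm h1 h2, mul_one] at h6
    have h7 : ⟪W (S+1) j, x i⟫ = ⟪W (S+1) j, ms μ₁ μ₂ (c i)⟫ +
        ⟪W (S+1) j, x i - ms μ₁ μ₂ (c i)⟫ := by rw [← inner_add_right]; simp
    have h8 := (abs_le.mp (abs_real_inner_le_norm (W (S+1) j) (x i - ms μ₁ μ₂ (c i)))).1
    have h9 : ‖W (S+1) j‖ * ‖x i - ms μ₁ μ₂ (c i)‖ ≤ b * (26/100) * δ' :=
      mul_le_mul (hWT _ le_rfl j) (hx i) (norm_nonneg _) (by positivity)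
    have h10 : b * (δ' + (1:ℕ) * α * (1 + δ')) ≤ b * (3 * δ') := by
      refine mul_le_mul_of_nonneg_left ?_ hb.le
      push_cast
      rw [hδ] at hαδ ⊢
      linarith
    have h11 : b * (3 * δ') = b * (3 / 10000) := by rw [hδ]; ring
    have h12 : b * (26/100) * δ' = b * (26/1000000) := by rw [hδ]; ring
    rw [h7]
    linarith
  have hneg : ∀ i, ∀ j ∈ JsetAll a (W 0) C₀ μ₁ μ₂, ls (c i) * a j < 0 →
      ⟪W (S+1) j, x i⟫ ≤ 5 * δ' * b := by
    intro i j hj hs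
    obtain ⟨-, hA1, hA2⟩ := hNA S (by omega) (by omega)
    have hAO : |⟪W S j, ms μ₁ μ₂ (c i)⟫| ≤ 3 * α * b := by
      rw [← ha j]
      simp only [JsetAll, mem_union] at hj
      generalize c i = k at hs ⊢
      have hmem : (j ∈ Jset a (W 0) C₀ μ₁ μ₂ 0 ∪ Jset a (W 0) C₀ μ₁ μ₂ 1 ∧ 0 < a j) ∨
          (j ∈ Jset a (W 0) C₀ μ₁ μ₂ 2 ∪ Jset a (W 0) C₀ μ₁ μ₂ 3 ∧ a j < 0) := by
        rcases hj with ((hj | hj) | hj) | hj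
        · left; have := Jset_sign hj; simp [ls] at this; simp [hj, this]
        · left; have := Jset_sign hj; simp [ls] at this; simp [hj, this]
        · right; have := Jset_sign hj; simp [ls] at this; simp [hj, this]
        · right; have := Jset_sign hj; simp [ls] at this; simp [hj, this]
      rcases hmem with ⟨hm, hp⟩ | ⟨hm, hp⟩
      · have := hA1 j hm
        fin_cases k <;> simp [ls, ms] at hs ⊢ <;> linarith
      · have := hA2 j hm
        fin_cases k <;> simp [ls, ms] at hs ⊢ <;> linarith
    have h7 : ⟪W (S+1) j, x i⟫ = ⟪W S j, ms μ₁ μ₂ (c i)⟫ +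
        ⟪W (S+1) j - W S j, ms μ₁ μ₂ (c i)⟫ + 
        ⟪W (S+1) j, x i - ms μ₁ μ₂ (c i)⟫ := by
      rw [inner_sub_left, inner_sub_right]; ring
    have h8 := (abs_le.mp (abs_real_inner_le_norm (W (S+1) j) (x i - ms μ₁ μ₂ (c i)))).2
    have h9 : ‖W (S+1) j‖ * ‖x i - ms μ₁ μ₂ (c i)‖ ≤ b * (26/100) * δ' :=
      mul_le_mul (hWT _ le_rfl j) (hx i) (norm_nonneg _) (by positivity)
    have h10 := (abs_le.mp (abs_real_inner_le_norm (W (S+1) j - W S j) (ms μ₁ μ₂ (c i)))).2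
    rw [ms_norm h1 h2, mul_one] at h10
    have h11 := hstep S j
    have h12 := (abs_le.mp hAO).2
    have h13 : α * b ≤ δ' * b := mul_le_mul_of_nonneg_right hαδ hb.le
    have h14 : α * b * (1+δ') ≤ δ' * b * (1 + δ') := mul_le_mul_of_nonneg_right h13 (by linarith)
    rw [h7]
    rw [hδ] at *
    linarith
  intro i
  unfold netOn
  rw [Finset.mul_sum]
  have hterm : ∀ j ∈ JsetAll a (W 0) C₀ μ₁ μ₂,
      (13/1000) * (b*b) * (if j ∈ Jset a (W 0) C₀ μ₁ μ₂ (c i) then 1 else 0) - 5 * δ' * (b * b) ≤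
      ls (c i) * (a j * relu ⟪W (S+1) j, x i⟫) := by
    intro j hj
    have hz : 0 ≤ 5 * δ' * (b * b) := by positivity
    have hab : |ls (c i) * a j| = b := by
      rw [abs_mul, ha j]; rcases ls_sq (c i) with h | h <;> simp [h]
    have hr : 0 ≤ relu ⟪W (S+1) j, x i⟫ := le_max_right _ _
    rw [← mul_assoc (ls (c i))]
    by_cases hm : j ∈ Jset a (W 0) C₀ μ₁ μ₂ (c i)
    · rw [if_pos hm]
      rw [abs_of_pos (Jset_sign hm)] at hab
      rw [hab]
      have h3 : (13/1000) * b ≤ relu ⟪W (S+1) j, x i⟫ := (hpos i j hm).trans (le_max_left _ _)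
      have := mul_le_mul_of_nonneg_left h3 hb.le
      linarith
    · rw [if_neg hm]
      rcases le_or_gt 0 (ls (c i) * a j) with h | h
      · have := mul_nonneg h hr
        linarith
      · rw [abs_of_neg h] at hab
        have h3 : relu ⟪W (S+1) j, x i⟫ ≤ 5 * δ' * b :=
          max_le (hneg i j hj h) (by positivity)
        have h4 := mul_le_mul_of_nonneg_left h3 hb.le
        have : ls (c i) * a j = -b := by linarith
        rw [this]
        linarith
  refine le_trans ?_ (Finset.sum_le_sum hterm)
  rw [Finset.sum_sub_distrib, ← Finset.mul_sum, Finset.sum_boole, Finset.sum_const, nsmul_eq_mul]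
  have hsub : Jset a (W 0) C₀ μ₁ μ₂ (c i) ⊆ JsetAll a (W 0) C₀ μ₁ μ₂ := by
    intro j hj
    simp only [JsetAll, mem_union]
    generalize c i = k at hj
    fin_cases k <;> simp_all
  rw [Finset.filter_mem_eq_inter, Finset.inter_eq_right.mpr hsub]
  have hcard : ((JsetAll a (W 0) C₀ μ₁ μ₂).card : ℝ) ≤ m := by
    have := Finset.card_le_univ (JsetAll a (W 0) C₀ μ₁ μ₂)
    simp at this
    exact_mod_cast this
  have := mul_le_mul_of_nonneg_right hcard (by positivity : 0 ≤ 5 * δ' * (b * b))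
  have h5 : (m:ℝ) * (5 * δ' * (b*b)) = 5 * δ' * (m * (b * b)) := by ring
  rw [h5, hmb] at this
  linarith

/-- the subnetwork-margin lemma.  Let `J = J_{±μ₁} ∪ J_{±μ₂}` be the candidate
neuron sets.  If neuron alignment and almost-orthogonality hold at times `τ = 1, …, T−1 = 1/(4α)`,
then on a good run, for all sufficiently large `C > 1`, at time `T = 1 + 1/(4α)` one has
`‖W^{(T)}‖_F ≤ 1`, `y_i f^J(x_i;W^{(T)}) ≥ 1/C₃` for all clean `i`, and
`y_i f^J(x_i;W^{(T)}) ≤ −1/C₃` for all noisy `i`, where `C₃ = 4096 e²/(1−1/C₀)²`. -/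
theorem statement7 :
    ∃ Cmin : ℝ, 1 < Cmin ∧
    ∀ C : ℝ, Cmin ≤ C →
    ∀ (d m n : ℕ) (δ σ η ωinit α C₁ C₂ : ℝ)
      (μ₁ μ₂ : EuclideanSpace ℝ (Fin d))
      (a : Fin m → ℝ) (D : ℝ → ℝ)
      (x : Fin n → EuclideanSpace ℝ (Fin d)) (c : Fin n → Fin 4) (y : Fin n → ℝ)
      (W : ℕ → Fin m → EuclideanSpace ℝ (Fin d)) (T : ℕ),
      1 ≤ m → 1 ≤ n →
      δ ∈ Set.Ioo (0:ℝ) (1/2) → 0 < σ → 0 ≤ η → 0 < ωinit →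
      2 ≤ C₁ → 1 < C₂ →
      ‖μ₁‖ = 1 → ‖μ₂‖ = 1 → ⟪μ₁, μ₂⟫ = 0 →
      (∀ j, a j = 1 / Real.sqrt m ∨ a j = -(1 / Real.sqrt m)) →
      IsReluDeriv D →
      (∀ i, y i = 1 ∨ y i = -1) →
      -- the gradient descent dynamics
      (∀ t, gdStep a D α x y (W t) (W (t+1))) →
      -- Assumptions (A1)-(A7)
      Assum C d m n δ σ η ωinit α →
      -- early stopping time T = 1 + 1/(4α)
      (T : ℝ) = 1 + 1/(4*α) →
      -- a good run occurs
      GoodRun a (W 0) C₁ C₂ σ δ η ωinit μ₁ μ₂ x c y D →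
      -- neuron alignment and almost-orthogonality at times 1, …, T − 1
      (∀ τ : ℕ, 1 ≤ τ → τ ≤ T - 1 →
        NAC a (W 0) C₀val μ₁ μ₂ x c D (W τ) ∧ AO a (W 0) C₀val μ₁ μ₂ α (W τ)) →
      frob (W T) ≤ 1 ∧
      (∀ i, y i = ls (c i) →
        1/C₃val ≤ y i * netOn (JsetAll a (W 0) C₀val μ₁ μ₂) a (W T) (x i)) ∧
      (∀ i, y i ≠ ls (c i) →
        y i * netOn (JsetAll a (W 0) C₀val μ₁ μ₂) a (W T) (x i) ≤ -(1/C₃val)) := by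
  refine ⟨10^16, by norm_num, ?_⟩
  intro C hC d m n δ σ η ωinit α C₁ C₂ μ₁ μ₂ a D x c y W T hm hn hδ hσ hη hω hC₁ hC₂ h1 h2 h12
    ha hD hy hgd hA hT hG hNA
  obtain ⟨-, A2, A3, A4, -, ⟨-, A6⟩, A7, A8⟩ := hA
  obtain ⟨G1, -, G3, -, -, G6, G7, G8, G9, G10, -⟩ := hG
  have hm' : (0:ℝ) < m := by exact_mod_cast hm
  have hn' : (0:ℝ) < n := by exact_mod_cast hn
  have hd : 0 < d := by
    rcases Nat.eq_zero_or_pos d with h | h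
    · subst h
      rw [Subsingleton.elim μ₁ 0] at h1
      simp at h1
    · exact h
  have hd' : (0:ℝ) < d := by exact_mod_cast hd
  have hC0 : 0 < C := by linarith
  have hC1 : 1/C ≤ 1/10^16 := one_div_le_one_div_of_le (by norm_num) hC
  have hCi : 0 < 1/C := by positivity
  have hsC : (10:ℝ)^8 ≤ Real.sqrt C := by
    rw [Real.le_sqrt (by norm_num) hC0.le]; linarith
  have hsC0 : 0 < Real.sqrt C := by linarith
  have hα : 0 < α := lt_of_lt_of_le (by positivity) A7
  have hαδ : α ≤ 1/10000 := by
    refine A8.trans ?_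
    apply one_div_le_one_div_of_le (by norm_num) (by linarith)
  have hsm : 0 < Real.sqrt m := Real.sqrt_pos.mpr hm'
  have hb : 0 < 1 / Real.sqrt m := by positivity
  have hbb : (1 / Real.sqrt m) * (1 / Real.sqrt m) = 1 / m := by
    rw [div_mul_div_comm, one_mul, Real.mul_self_sqrt hm'.le]
  have ha' : ∀ j, |a j| = 1 / Real.sqrt m := by
    intro j
    rcases ha j with h | h <;> rw [h]
    · exact abs_of_pos hb
    · rw [abs_neg]; exact abs_of_pos hb
  have hW0 : ∀ j, ‖W 0 j‖ ≤ 1/10000 * (1 / Real.sqrt m) := by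
    intro j
    refine (G1 j).2.trans ?_
    apply le_of_sq_aux _ (by positivity)
    have e1 : (3/2 * (ωinit * Real.sqrt d))^2 = 9/4 * (ωinit^2 * d) := by
      rw [mul_pow, mul_pow, Real.sq_sqrt hd'.le]; ring
    have e2 : (1/10000 * (1 / Real.sqrt m))^2 = 1/10^8 * (1/m) := by
      rw [mul_pow, sq (1 / Real.sqrt m), hbb]; norm_num
    rw [e1, e2]
    have e3 : ωinit^2 * d ≤ (1/C)^4 * (1/m) := by
      have := mul_le_mul_of_nonneg_right A6 hd'.le
      have e : 1/(C^4*m*d) * d = (1/C)^4 * (1/m) := by field_simp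
      rwa [e] at this
    have e4 : (1/C)^4 ≤ (1/10^16)^4 := pow_le_pow_left₀ hCi.le hC1 4
    have e5 : (0:ℝ) < 1/m := by positivity
    have e6 := mul_le_mul_of_nonneg_right e4 e5.le
    have e7 : ((1:ℝ)/10^16)^4 * (1/m) ≤ 1/10^10 * (1/m) :=
      mul_le_mul_of_nonneg_right (by norm_num) e5.le
    linarith
  have hx : ∀ i, ‖x i - ms μ₁ μ₂ (c i)‖ ≤ 1/10000 := by
    intro i
    apply le_of_sq_aux _ (by norm_num)
    refine (G6 (c i) i rfl).trans ?_
    have e1 : σ^2 * d ≤ (1/C)^2 := by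
      have := mul_le_mul_of_nonneg_right A2 hd'.le
      have e : 1/(C^2*d) * d = (1/C)^2 := by field_simp
      rwa [e] at this
    have e2 : (C₁ * σ^2 * d)^2 ≤ (1/C)^2 := by
      have hC1p : 0 < C₁ := by linarith
      have e3 : C₁ * (C₁ * σ^2 * d) ≤ 1 := by
        have := mul_le_mul_of_nonneg_left G7 hC1p.le
        rwa [mul_one_div_cancel hC1p.ne'] at this
      have e4 : 0 ≤ σ^2 * d := by positivity
      calc (C₁ * σ^2 * d)^2 = (C₁ * (C₁ * σ^2 * d)) * (σ^2 * d) := by ring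
        _ ≤ 1 * (σ^2 * d) := mul_le_mul_of_nonneg_right e3 e4
        _ ≤ _ := by linarith
    have e5 := le_of_sq_aux e2 hCi.le
    norm_num at hC1 e5 ⊢
    linarith
  have hR : C₁ * Real.sqrt (Real.log (1/δ) / n) ≤ 1/10000 := by
    have hC1p : 0 < C₁ := by linarith
    have e1 : Real.log (1/δ) / n ≤ 1/C := by
      rw [div_le_div_iff₀ hn' hC0]
      have : Real.log (1/δ) ≤ Real.log (m/δ) := by
        apply Real.log_le_log
        · have := hδ.1; positivity
        · apply div_le_div_of_nonneg_right _ hδ.1.le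
          exact_mod_cast hm
      nlinarith
    have e2 : Real.sqrt (Real.log (1/δ) / n) ≤ 1/10^8 := by
      rw [Real.sqrt_le_left (by norm_num)]
      refine e1.trans (hC1.trans ?_)
      norm_num
    have e3 : C₁ * Real.sqrt (Real.log (1/δ) / n) ≤ 1/C₁ := by linarith
    have e0 := Real.sqrt_nonneg (Real.log (1/δ) / n)
    generalize Real.sqrt (Real.log (1/δ) / n) = R at e2 e3 e0 ⊢
    have e4 : C₁ * (C₁ * R) ≤ 1 := by
      have := mul_le_mul_of_nonneg_left e3 hC1p.le
      rwa [mul_one_div_cancel hC1p.ne'] at this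
    apply le_of_sq_aux _ (by norm_num)
    calc (C₁ * R)^2 = C₁ * (C₁ * R) * R := by ring
      _ ≤ 1 * R := mul_le_mul_of_nonneg_right e4 e0
      _ ≤ _ := by norm_num at e2 ⊢; linarith
  have hnoise : ((univ.filter (fun i : Fin n => y i ≠ ls (c i))).card : ℝ) ≤ 2 * (1/10000) * n := by
    rw [← div_le_iff₀ hn']
    refine G8.trans ?_
    norm_num at hC1 A4 hR ⊢
    linarith
  have hcl : ∀ k, (1/4 - 1/10000) * n ≤ ((univ.filter (fun i : Fin n => c i = k)).card : ℝ) := by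
    intro k
    rw [← le_div_iff₀ hn']
    refine le_trans ?_ (G10 k).1
    linarith
  obtain ⟨K1, K2⟩ := core (δ' := 1/10000) rfl hn hb (by rw [hbb]; field_simp) h1 h2 h12 ha' hD hy hgd
    hα hαδ hT hW0 hx hnoise hcl hNA
  have key : ∀ i, 1/C₃val ≤ ls (c i) * netOn (JsetAll a (W 0) C₀val μ₁ μ₂) a (W T) (x i) := by
    intro i
    refine le_trans ?_ (K2 i)
    have hq := C₀val_q
    have h3 := G3 (c i)
    have h3' : (1 - 1/C₀val)^2 / 4 ≤ 1/m * ((Jset a (W 0) C₀val μ₁ μ₂ (c i)).card : ℝ) := by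
      rw [one_div_mul_eq_div, le_div_iff₀ hm']
      linarith
    unfold C₃val
    generalize (1 - 1/C₀val)^2 = q at *
    rw [hbb, one_div_div]
    have h4 : q / (4096 * Real.exp 2) ≤ q / 4096 := by
      apply div_le_div_of_nonneg_left (by linarith) (by norm_num)
      have := Real.one_le_exp (by norm_num : (0:ℝ) ≤ 2)
      linarith
    rw [mul_assoc]
    linarith [hq.1, hq.2]
  refine ⟨K1, ?_, ?_⟩
  · intro i hi
    rw [hi]; exact key i
  · intro i hi
    have hyk : y i = - ls (c i) := neg_of_ne_aux (hy i) (ls_sq (c i)) hi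
    rw [hyk]
    have := key i
    linarith
end
end

section
/- In the noiseless setting η = 0, under Assumptions (A1)-(A3) (in particular σ² ≤ 1/(C²d) and d ≥ C log²(n/δ) for sufficiently large absolute C), the classifier x ↦ sgn(ν(x)) with ν(x) = |⟨μ₁,x⟩| − |⟨μ₂,x⟩| satisfies P_{(x,ỹ)∼P̃}( sgn(ν(x)) ≠ ỹ ) ≤ C'·√(log(1/δ)/n) for an absolute constant C' > 0. -/
open MeasureTheory Finset
open scoped RealInnerProductSpace ENNReal BigOperators
noncomputable section

/-- `P` is a log-concave probability measure on `ℝ^d` with mean `0` and covariance `σ²·I_d`. -/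
def IsLogConcaveIso {d : ℕ} (σ : ℝ) (P : Measure (EuclideanSpace ℝ (Fin d))) : Prop :=
  IsProbabilityMeasure P ∧
  (∃ U : EuclideanSpace ℝ (Fin d) → ℝ, ConvexOn ℝ Set.univ U ∧
    P = MeasureTheory.volume.withDensity (fun x => ENNReal.ofReal (Real.exp (-U x)))) ∧
  (∫ x, x ∂P) = 0 ∧
  (∀ v : EuclideanSpace ℝ (Fin d), ∫ x, (⟪v, x⟫ : ℝ)^2 ∂P = σ^2 * ‖v‖^2)

/-- The distribution of `(cluster index, x)` for a clean sample. -/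
def Qclean {d : ℕ} (μ₁ μ₂ : EuclideanSpace ℝ (Fin d))
    (Pclust : Measure (EuclideanSpace ℝ (Fin d))) :
    Measure (Fin 4 × EuclideanSpace ℝ (Fin d)) :=
  (4 : ℝ≥0∞)⁻¹ • ∑ k : Fin 4, Measure.map (fun z => (k, ms μ₁ μ₂ k + z)) Pclust

/-- The clean data distribution `P̃` on pairs `(x, ỹ)`. -/
def Pclean {d : ℕ} (μ₁ μ₂ : EuclideanSpace ℝ (Fin d))
    (Pclust : Measure (EuclideanSpace ℝ (Fin d))) :
    Measure (EuclideanSpace ℝ (Fin d) × ℝ) :=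
  (Qclean μ₁ μ₂ Pclust).map (fun p => (p.2, ls p.1))

theorem amgm4 (x y : ℝ≥0∞) : 4 * (x * y) ≤ (x + y)^2 := by
  rcases le_total x y with h | h
  · obtain ⟨e, rfl⟩ := exists_add_of_le h
    calc 4 * (x * (x + e)) ≤ 4 * (x * (x + e)) + e^2 := le_self_add
      _ = _ := by ring
  · obtain ⟨e, rfl⟩ := exists_add_of_le h
    calc 4 * ((y + e) * y) ≤ 4 * ((y + e) * y) + e^2 := le_self_add
      _ = _ := by ring

theorem bm_compact {K L N : Set ℝ} (hK : IsCompact K) (hL : IsCompact L) (hKn : K.Nonempty)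
    (hLn : L.Nonempty) (hN : ∀ x ∈ K, ∀ y ∈ L, x + y ∈ N) :
    volume K + volume L ≤ volume N := by
  obtain ⟨k, hk, hkm⟩ := hK.exists_isGreatest hKn
  obtain ⟨l, hl, hlm⟩ := hL.exists_isLeast hLn
  have h1 : volume K ≤ volume (N ∩ Set.Iic (k + l)) := by
    rw [← measure_preimage_add_right volume l (N ∩ Set.Iic (k + l))]
    apply measure_mono
    intro x hx
    have := hkm hx
    exact ⟨hN x hx l hl, by simpa using this⟩
  have h2 : volume L ≤ volume (N ∩ Set.Ici (k + l)) := by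
    rw [← measure_preimage_add volume k (N ∩ Set.Ici (k + l))]
    apply measure_mono
    intro x hx
    have := hlm hx
    exact ⟨hN k hk x hx, by simpa using this⟩
  have h3 : volume (N ∩ Set.Ici (k + l)) = volume (N \ Set.Iic (k + l)) := by
    rw [Set.sdiff_eq, Set.compl_Iic]
    exact measure_congr ((ae_eq_refl _).inter Ioi_ae_eq_Ici.symm)
  rw [← measure_inter_add_sdiff N (measurableSet_Iic (a := k + l)), ← h3]
  exact add_le_add h1 h2

theorem bm {A B N : Set ℝ} (hA : MeasurableSet A) (hB : MeasurableSet B) (hAn : A.Nonempty)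
    (hBn : B.Nonempty) (hN : ∀ x ∈ A, ∀ y ∈ B, x + y ∈ N) :
    volume A + volume B ≤ volume N := by
  obtain ⟨a, ha⟩ := hAn
  obtain ⟨b, hb⟩ := hBn
  rw [hA.measure_eq_iSup_isCompact, hB.measure_eq_iSup_isCompact]
  simp only [iSup_and']
  have key : ∀ K : {K : Set ℝ // K ⊆ A ∧ IsCompact K}, ∀ L : {L : Set ℝ // L ⊆ B ∧ IsCompact L},
      volume K.1 + volume L.1 ≤ volume N := by
    rintro ⟨K, hKA, hK⟩ ⟨L, hLB, hL⟩
    calc volume K + volume L ≤ volume (insert a K) + volume (insert b L) :=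
          add_le_add (measure_mono (Set.subset_insert _ _)) (measure_mono (Set.subset_insert _ _))
      _ ≤ _ := bm_compact (hK.insert a) (hL.insert b) (Set.insert_nonempty _ _)
          (Set.insert_nonempty _ _) (fun x hx y hy => hN x
            (Set.insert_subset ha hKA hx) y (Set.insert_subset hb hLB hy))
  simp only [iSup_subtype'] 
  have : Nonempty {K : Set ℝ // K ⊆ A ∧ IsCompact K} := ⟨⟨∅, by simp⟩⟩
  have : Nonempty {K : Set ℝ // K ⊆ B ∧ IsCompact K} := ⟨⟨∅, by simp⟩⟩
  exact ENNReal.iSup_add_iSup_le key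

theorem bm_mid {A B M : Set ℝ} (hA : MeasurableSet A) (hB : MeasurableSet B) (hAn : A.Nonempty)
    (hBn : B.Nonempty) (hN : ∀ x ∈ A, ∀ y ∈ B, (x + y) / 2 ∈ M) :
    volume A + volume B ≤ 2 * volume M := by
  have := bm (N := (fun x => x * (1/2 : ℝ)) ⁻¹' M) hA hB hAn hBn (by
    intro x hx y hy
    have := hN x hx y hy
    simpa [div_eq_mul_inv] using this)
  rw [Real.volume_preimage_mul_right (by norm_num)] at this
  simpa using this

theorem pl_norm {f g h : ℝ → ℝ≥0∞} (hf : Measurable f) (hg : Measurable g) (hh : Measurable h)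
    (hf1 : ⨆ x, f x = 1) (hg1 : ⨆ x, g x = 1)
    (H : ∀ x y, f x * g y ≤ h ((x + y) / 2) ^ 2) :
    (∫⁻ x, f x) + ∫⁻ x, g x ≤ 2 * ∫⁻ x, h x := by
  have lc : ∀ u : ℝ → ℝ≥0∞, Measurable u → (∀ x, u x ≤ 1) →
      ∫⁻ x, u x = ∫⁻ t in Set.Ioi (0:ℝ), volume {a | t < (u a).toReal} := by
    intro u hu hu1
    rw [← lintegral_eq_lintegral_meas_lt _ (Filter.Eventually.of_forall fun x => by simp)
      hu.ennreal_toReal.aemeasurable]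
    refine lintegral_congr fun x => (ENNReal.ofReal_toReal ?_).symm
    exact ne_top_of_le_ne_top ENNReal.one_ne_top (hu1 x)
  have hfl : ∀ x, f x ≤ 1 := fun x => hf1 ▸ le_iSup f x
  have hgl : ∀ x, g x ≤ 1 := fun x => hg1 ▸ le_iSup g x
  have hle : ∫⁻ x, min (h x) 1 ≤ ∫⁻ x, h x := lintegral_mono fun x => min_le_left _ _
  refine le_trans ?_ (mul_le_mul_right hle 2)
  have am : ∀ u : ℝ → ℝ≥0∞, Measurable (fun t : ℝ => volume {a | t < (u a).toReal}) := by
    intro u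
    apply Antitone.measurable
    intro s t hst
    exact measure_mono fun a (ha : t < _) => lt_of_le_of_lt hst ha
  rw [lc f hf hfl, lc g hg hgl, lc (fun x => min (h x) 1) (hh.min measurable_const)
    (fun x => min_le_right _ _), ← lintegral_add_left (am f), ← lintegral_const_mul _ (am _)]
  refine setLIntegral_mono ((am _).const_mul 2) ?_
  intro t ht
  have ht0 : (0:ℝ) < t := ht
  have tr : ∀ u : ℝ≥0∞, u ≤ 1 → (t < u.toReal ↔ ENNReal.ofReal t < u) := by
    intro u hu
    rw [ENNReal.ofReal_lt_iff_lt_toReal ht0.le (ne_top_of_le_ne_top ENNReal.one_ne_top hu)]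
  have e1 : {a | t < (f a).toReal} = {a | ENNReal.ofReal t < f a} := by
    ext a; exact tr _ (hfl a)
  have e2 : {a | t < (g a).toReal} = {a | ENNReal.ofReal t < g a} := by
    ext a; exact tr _ (hgl a)
  have e3 : {a | t < (min (h a) 1).toReal} = {a | ENNReal.ofReal t < min (h a) 1} := by
    ext a; exact tr _ (min_le_right _ _)
  simp only [e1, e2, e3]
  set τ := ENNReal.ofReal t
  by_cases hτ : τ < 1
  · apply bm_mid (measurableSet_lt measurable_const hf) (measurableSet_lt measurable_const hg)
    · exact lt_iSup_iff.1 (hf1 ▸ hτ)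
    · exact lt_iSup_iff.1 (hg1 ▸ hτ)
    · intro x hx y hy
      refine lt_min ?_ hτ
      have h1 : τ ^ 2 < h ((x + y) / 2) ^ 2 := by
        refine lt_of_lt_of_le ?_ (H x y)
        rw [sq]
        exact ENNReal.mul_lt_mul hx hy
      by_contra hcon
      exact absurd h1 (not_lt.2 (pow_le_pow_left' (not_lt.1 hcon) 2))
  · have h1 : {a | τ < f a} = ∅ := by
      ext a; simp; exact (hfl a).trans (not_lt.1 hτ)
    have h2 : {a | τ < g a} = ∅ := by
      ext a; simp; exact (hgl a).trans (not_lt.1 hτ)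
    simp [h1, h2]

theorem pl_bdd {f g h : ℝ → ℝ≥0∞} (hf : Measurable f) (hg : Measurable g) (hh : Measurable h)
    (hf1 : ⨆ x, f x ≠ ∞) (hg1 : ⨆ x, g x ≠ ∞)
    (H : ∀ x y, f x * g y ≤ h ((x + y) / 2) ^ 2) :
    (∫⁻ x, f x) * ∫⁻ x, g x ≤ (∫⁻ x, h x) ^ 2 := by
  set a := ⨆ x, f x with ha
  set b := ⨆ x, g x with hb
  by_cases ha0 : a = 0
  · have : ∀ x, f x = 0 := fun x => by
      have := le_iSup f x; rw [← ha, ha0] at this; simpa using this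
    simp [this]
  by_cases hb0 : b = 0
  · have : ∀ x, g x = 0 := fun x => by
      have := le_iSup g x; rw [← hb, hb0] at this; simpa using this
    simp [this]
  set c := (a * b) ^ (1/2 : ℝ) with hc
  have hc2 : c ^ 2 = a * b := by
    rw [hc, ← ENNReal.rpow_natCast, ← ENNReal.rpow_mul]; norm_num
  have hab0 : a * b ≠ 0 := mul_ne_zero ha0 hb0
  have habt : a * b ≠ ∞ := ENNReal.mul_ne_top hf1 hg1
  have key := pl_norm (f := fun x => a⁻¹ * f x) (g := fun x => b⁻¹ * g x)
    (h := fun x => c⁻¹ * h x) (hf.const_mul _) (hg.const_mul _) (hh.const_mul _)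
    (by rw [← ENNReal.mul_iSup, ← ha, ENNReal.inv_mul_cancel ha0 hf1])
    (by rw [← ENNReal.mul_iSup, ← hb, ENNReal.inv_mul_cancel hb0 hg1])
    (by
      intro x y
      rw [mul_pow, ← ENNReal.inv_pow, hc2, ENNReal.mul_inv (Or.inl ha0) (Or.inl hf1)]
      calc a⁻¹ * f x * (b⁻¹ * g y) = a⁻¹ * b⁻¹ * (f x * g y) := by ring
        _ ≤ _ := mul_le_mul_right (H x y) _)
  rw [lintegral_const_mul _ hf, lintegral_const_mul _ hg, lintegral_const_mul _ hh] at key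
  have k2 := (amgm4 _ _).trans (pow_le_pow_left₀ (by simp) key 2)
  have e1 : 4 * (a⁻¹ * (∫⁻ x, f x) * (b⁻¹ * ∫⁻ x, g x)) =
      4 * (a * b)⁻¹ * ((∫⁻ x, f x) * ∫⁻ x, g x) := by
    rw [ENNReal.mul_inv (Or.inl ha0) (Or.inl hf1)]; ring
  have e2 : (2 * (c⁻¹ * ∫⁻ x, h x)) ^ 2 = 4 * (a * b)⁻¹ * (∫⁻ x, h x) ^ 2 := by
    rw [mul_pow, mul_pow, ← ENNReal.inv_pow, hc2]; ring
  rw [e1, e2] at k2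
  exact (ENNReal.mul_le_mul_iff_right (mul_ne_zero (by norm_num) (ENNReal.inv_ne_zero.2 habt))
    (ENNReal.mul_ne_top (by norm_num) (ENNReal.inv_ne_top.2 hab0))).1 k2

theorem trunc {f : ℝ → ℝ≥0∞} (hf : Measurable f) :
    ∫⁻ x, f x = ⨆ n : ℕ, ∫⁻ x, min (f x) n := by
  rw [← lintegral_iSup (fun n => hf.min measurable_const)
    (fun i j hij x => min_le_min le_rfl (by exact_mod_cast hij))]
  refine lintegral_congr fun x => le_antisymm ?_ (iSup_le fun n => min_le_left _ _)
  refine le_of_forall_lt fun c hc => ?_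
  obtain ⟨n, hn⟩ := ENNReal.exists_nat_gt (ne_top_of_lt hc)
  exact lt_of_lt_of_le (lt_min hc hn) (le_iSup (fun n : ℕ => min (f x) (n : ℝ≥0∞)) n)

theorem pl_one {f g h : ℝ → ℝ≥0∞} (hf : Measurable f) (hg : Measurable g) (hh : Measurable h)
    (H : ∀ x y, f x * g y ≤ h ((x + y) / 2) ^ 2) :
    (∫⁻ x, f x) * ∫⁻ x, g x ≤ (∫⁻ x, h x) ^ 2 := by
  rw [trunc hf, trunc hg, ENNReal.iSup_mul]
  refine iSup_le fun n => ?_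
  rw [ENNReal.mul_iSup]
  refine iSup_le fun m => ?_
  apply pl_bdd (hf.min measurable_const) (hg.min measurable_const) hh
  · exact ne_top_of_le_ne_top (ENNReal.natCast_ne_top n) (iSup_le fun x => min_le_right _ _)
  · exact ne_top_of_le_ne_top (ENNReal.natCast_ne_top m) (iSup_le fun x => min_le_right _ _)
  · exact fun x y => (mul_le_mul' (min_le_left _ _) (min_le_left _ _)).trans (H x y)

theorem pl_pi (d : ℕ) : ∀ {f g h : (Fin d → ℝ) → ℝ≥0∞}, Measurable f → Measurable g →
    Measurable h → (∀ x y, f x * g y ≤ h ((1/2 : ℝ) • (x + y)) ^ 2) →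
    (∫⁻ x, f x) * ∫⁻ x, g x ≤ (∫⁻ x, h x) ^ 2 := by
  induction d with
  | zero =>
    intro f g h hf hg hh H
    have := H default default
    simp only [volume_pi, Measure.pi_of_empty _ (default : Fin 0 → ℝ), lintegral_dirac]
    convert this
  | succ d ih =>
    intro f g h hf hg hh H
    have mp := (volume_preserving_piFinSuccAbove (fun _ : Fin (d+1) => ℝ) 0).symm
    set e := (MeasurableEquiv.piFinSuccAbove (fun _ : Fin (d+1) => ℝ) 0).symm
    have conv : ∀ u : (Fin (d+1) → ℝ) → ℝ≥0∞, Measurable u →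
        ∫⁻ x, u x = ∫⁻ s : ℝ, ∫⁻ y : Fin d → ℝ, u (e (s, y)) := by
      intro u hu
      rw [← mp.lintegral_comp hu, Measure.volume_eq_prod]
      exact lintegral_prod _ (hu.comp e.measurable).aemeasurable
    rw [conv f hf, conv g hg, conv h hh]
    have me : ∀ u : (Fin (d+1) → ℝ) → ℝ≥0∞, Measurable u →
        Measurable (fun s : ℝ => ∫⁻ y : Fin d → ℝ, u (e (s, y))) := fun u hu =>
      Measurable.lintegral_prod_right' (hu.comp e.measurable)
    apply pl_one (me f hf) (me g hg) (me h hh)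
    intro s t
    apply ih (hf.comp (e.measurable.comp measurable_prodMk_left))
      (hg.comp (e.measurable.comp measurable_prodMk_left))
      (hh.comp (e.measurable.comp measurable_prodMk_left))
    intro x y
    have hE : e ((s + t) / 2, (1/2 : ℝ) • (x + y)) = (1/2 : ℝ) • (e (s, x) + e (t, y)) := by
      ext i
      refine Fin.cases ?_ (fun j => ?_) i
      · simp [e, MeasurableEquiv.piFinSuccAbove]; ring
      · simp [e, MeasurableEquiv.piFinSuccAbove]; ring
    have := H (e (s, x)) (e (t, y))
    rw [← hE] at this
    exact this

theorem pl_euc {d : ℕ} {f g h : EuclideanSpace ℝ (Fin d) → ℝ≥0∞} (hf : Measurable f)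
    (hg : Measurable g) (hh : Measurable h)
    (H : ∀ x y, f x * g y ≤ h ((1/2 : ℝ) • (x + y)) ^ 2) :
    (∫⁻ x, f x) * ∫⁻ x, g x ≤ (∫⁻ x, h x) ^ 2 := by
  have mp := PiLp.volume_preserving_toLp (Fin d)
  rw [← mp.lintegral_comp hf, ← mp.lintegral_comp hg, ← mp.lintegral_comp hh]
  apply pl_pi d (hf.comp mp.measurable) (hg.comp mp.measurable) (hh.comp mp.measurable)
  intro x y
  have := H (WithLp.toLp 2 x) (WithLp.toLp 2 y)
  simpa using this

theorem iso_logconc {d : ℕ} {σ : ℝ} {P : Measure (EuclideanSpace ℝ (Fin d))}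
    (hP : IsLogConcaveIso σ P) (v : EuclideanSpace ℝ (Fin d)) (s t : ℝ) :
    P {x | s ≤ ⟪v, x⟫} * P {x | t ≤ ⟪v, x⟫} ≤ P {x | (s + t) / 2 ≤ ⟪v, x⟫} ^ 2 := by
  obtain ⟨-, ⟨U, hU, rfl⟩, -, -⟩ := hP
  have hUc : Continuous U := by
    rw [← continuousOn_univ]; exact hU.continuousOn isOpen_univ
  have hρ : Measurable (fun x => ENNReal.ofReal (Real.exp (-U x))) :=
    (ENNReal.continuous_ofReal.comp (Real.continuous_exp.comp hUc.neg)).measurable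
  have hS : ∀ s : ℝ, MeasurableSet {x : EuclideanSpace ℝ (Fin d) | s ≤ ⟪v, x⟫} := fun s =>
    measurableSet_le measurable_const (by fun_prop)
  rw [withDensity_apply _ (hS _), withDensity_apply _ (hS _), withDensity_apply _ (hS _),
    ← lintegral_indicator (hS _), ← lintegral_indicator (hS _), ← lintegral_indicator (hS _)]
  apply pl_euc (hρ.indicator (hS _)) (hρ.indicator (hS _)) (hρ.indicator (hS _))
  intro x y
  by_cases hx : s ≤ ⟪v, x⟫
  · by_cases hy : t ≤ ⟪v, y⟫
    · have hm : (s + t) / 2 ≤ ⟪v, (1/2 : ℝ) • (x + y)⟫ := by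
        rw [inner_smul_right, inner_add_right]; linarith
      rw [Set.indicator_of_mem (show x ∈ {x | s ≤ ⟪v, x⟫} from hx),
        Set.indicator_of_mem (show y ∈ {x | t ≤ ⟪v, x⟫} from hy),
        Set.indicator_of_mem (show (1/2 : ℝ) • (x + y) ∈ {x | (s + t) / 2 ≤ ⟪v, x⟫} from hm),
        ← ENNReal.ofReal_mul (Real.exp_pos _).le, ← ENNReal.ofReal_pow (Real.exp_pos _).le,
        ← Real.exp_add, ← Real.exp_nat_mul]
      apply ENNReal.ofReal_le_ofReal
      apply Real.exp_le_exp.2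
      have := hU.2 (Set.mem_univ x) (Set.mem_univ y) (show (0:ℝ) ≤ 1/2 by norm_num)
        (show (0:ℝ) ≤ 1/2 by norm_num) (by norm_num)
      rw [← smul_add] at this
      simp only [smul_eq_mul] at this
      push_cast
      linarith
    · rw [Set.indicator_of_notMem (show y ∉ {x | t ≤ ⟪v, x⟫} from hy)]; simp
  · rw [Set.indicator_of_notMem (show x ∉ {x | s ≤ ⟪v, x⟫} from hx)]; simp

theorem iso_tail {d : ℕ} {σ : ℝ} {P : Measure (EuclideanSpace ℝ (Fin d))} (hσ : 0 < σ)
    (hP : IsLogConcaveIso σ P) (v : EuclideanSpace ℝ (Fin d)) (hv : ‖v‖ = 1) (k : ℕ) :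
    P.real {x | (4 * k - 2) * σ ≤ ⟪v, x⟫} ≤ (1/3 : ℝ) ^ k := by
  have hlc := iso_logconc hP v
  obtain ⟨hprob, -, -, hcov⟩ := hP
  have hc := hcov v
  rw [hv] at hc
  have hint : Integrable (fun x => (⟪v, x⟫ : ℝ)^2) P := by
    by_contra hcon
    rw [integral_undef hcon] at hc
    have : 0 < σ^2 := by positivity
    linarith
  have hch := mul_meas_ge_le_integral_of_nonneg
    (Filter.Eventually.of_forall fun x => sq_nonneg (⟪v, x⟫ : ℝ)) hint ((2*σ)^2)
  rw [hc] at hch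
  have hs2 : 0 < σ^2 := by positivity
  have hch' : P.real {x | (2*σ)^2 ≤ (⟪v, x⟫ : ℝ)^2} ≤ 1/4 := by
    nlinarith
  set r : ℕ → ℝ := fun k => P.real {x | (4 * k - 2) * σ ≤ ⟪v, x⟫} with hr
  have r0 : 3/4 ≤ r 0 := by
    have hm : MeasurableSet {x : EuclideanSpace ℝ (Fin d) | (2*σ)^2 ≤ (⟪v, x⟫ : ℝ)^2} :=
      measurableSet_le measurable_const (by fun_prop)
    have h1 := probReal_compl_eq_one_sub (μ := P) hm
    have h2 : P.real {x : EuclideanSpace ℝ (Fin d) | (2*σ)^2 ≤ (⟪v, x⟫ : ℝ)^2}ᶜ ≤ r 0 := by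
      refine measureReal_mono ?_
      intro x hx
      simp only [Set.mem_compl_iff, Set.mem_ofPred_eq, not_le] at hx ⊢
      have := abs_lt_of_sq_lt_sq' hx (by positivity)
      push_cast
      linarith [this.1]
    linarith
  have r1 : r 1 ≤ 1/4 := by
    refine le_trans (measureReal_mono ?_) hch'
    intro x hx
    simp only [Set.mem_ofPred_eq] at hx ⊢
    push_cast at hx
    exact pow_le_pow_left₀ (by positivity) (by linarith) 2
  have rnn : ∀ k, 0 ≤ r k := fun k => measureReal_nonneg
  have rmono : ∀ k, r (k+1) ≤ r k := by
    intro k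
    refine measureReal_mono ?_
    intro x hx
    simp only [Set.mem_ofPred_eq] at hx ⊢
    push_cast at hx
    linarith
  have rlc : ∀ k, r k * r (k+2) ≤ r (k+1) ^ 2 := by
    intro k
    have := hlc ((4 * (k:ℝ) - 2) * σ) ((4 * ((k+2 : ℕ):ℝ) - 2) * σ)
    have e : ((4 * (k:ℝ) - 2) * σ + (4 * ((k+2 : ℕ):ℝ) - 2) * σ) / 2
        = (4 * ((k+1 : ℕ):ℝ) - 2) * σ := by push_cast; ring
    rw [e] at this
    have := ENNReal.toReal_mono (by finiteness) this
    rw [ENNReal.toReal_mul, ENNReal.toReal_pow] at this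
    exact this
  have step : ∀ k, r (k+1) ≤ 1/3 * r k := by
    intro k
    induction k with
    | zero => simp only [zero_add]; linarith
    | succ k ih =>
      rcases (rnn k).eq_or_lt with h | h
      · have := rmono k
        have := rmono (k+1)
        have := rnn (k+1)
        have : r (k+1) = 0 := by linarith
        rw [this] at *
        linarith
      · have h1 := rlc k
        have h2 : r k * r (k+2) ≤ r k * (1/3 * r (k+1)) := by
          nlinarith [rnn (k+1)]
        exact le_of_mul_le_mul_left h2 h
  change r k ≤ _
  induction k with
  | zero => rw [pow_zero]; exact measureReal_le_one
  | succ k ih =>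
    rw [pow_succ]
    linarith [step k]

theorem abs_tail {d : ℕ} {σ : ℝ} {P : Measure (EuclideanSpace ℝ (Fin d))} (hσ : 0 < σ)
    (hP : IsLogConcaveIso σ P) (v : EuclideanSpace ℝ (Fin d)) (hv : ‖v‖ = 1) (k : ℕ)
    (hk : (4 * k - 2) * σ ≤ 1/2) :
    P {x | 1/2 ≤ |⟪v, x⟫|} ≤ ENNReal.ofReal (2 * (1/3 : ℝ) ^ k) := by
  have h1 := iso_tail hσ hP v hv k
  have h2 := iso_tail hσ hP (-v) (by simpa using hv) k
  obtain ⟨hprob, -⟩ := hP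
  have hsub : {x : EuclideanSpace ℝ (Fin d) | 1/2 ≤ |⟪v, x⟫|} ⊆
      {x | (4 * k - 2) * σ ≤ ⟪v, x⟫} ∪ {x | (4 * k - 2) * σ ≤ ⟪-v, x⟫} := by
    intro x hx
    simp only [Set.mem_ofPred_eq, le_abs] at hx
    rcases hx with hx | hx
    · left; exact hk.trans hx
    · right; simp only [Set.mem_ofPred_eq, inner_neg_left]; exact hk.trans hx
  rw [← ofReal_measureReal]
  apply ENNReal.ofReal_le_ofReal
  calc _ ≤ _ := measureReal_mono hsub
    _ ≤ _ := measureReal_union_le _ _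
    _ ≤ _ := by linarith

theorem real_sign_measurable : Measurable Real.sign := by
  unfold Real.sign
  exact Measurable.ite measurableSet_Iio measurable_const
    (Measurable.ite measurableSet_Ioi measurable_const measurable_const)

theorem Pclean_le {d : ℕ} {μ₁ μ₂ : EuclideanSpace ℝ (Fin d)}
    {P : Measure (EuclideanSpace ℝ (Fin d))} (h1 : ‖μ₁‖ = 1) (h2 : ‖μ₂‖ = 1)
    (h12 : (⟪μ₁, μ₂⟫ : ℝ) = 0) :
    Pclean μ₁ μ₂ P {p : EuclideanSpace ℝ (Fin d) × ℝ |
            Real.sign (|⟪μ₁, p.1⟫| - |⟪μ₂, p.1⟫|) ≠ p.2} ≤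
      P {x | 1/2 ≤ |(⟪μ₁, x⟫ : ℝ)|} + P {x | 1/2 ≤ |(⟪μ₂, x⟫ : ℝ)|} := by
  have hS : MeasurableSet {p : EuclideanSpace ℝ (Fin d) × ℝ |
            Real.sign (|⟪μ₁, p.1⟫| - |⟪μ₂, p.1⟫|) ≠ p.2} := by
    have : MeasurableSet {p : EuclideanSpace ℝ (Fin d) × ℝ |
            Real.sign (|⟪μ₁, p.1⟫| - |⟪μ₂, p.1⟫|) = p.2} :=
      measurableSet_eq_fun (real_sign_measurable.comp (by fun_prop)) measurable_snd
    exact this.compl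
  have hmap : Measurable (fun p : Fin 4 × EuclideanSpace ℝ (Fin d) => (p.2, ls p.1)) :=
    measurable_snd.prodMk ((measurable_of_finite ls).comp measurable_fst)
  have h21 : (⟪μ₂, μ₁⟫ : ℝ) = 0 := by rw [real_inner_comm]; exact h12
  have n1 : (⟪μ₁, μ₁⟫ : ℝ) = 1 := by rw [real_inner_self_eq_norm_sq, h1]; norm_num
  have n2 : (⟪μ₂, μ₂⟫ : ℝ) = 1 := by rw [real_inner_self_eq_norm_sq, h2]; norm_num
  set B := P {x | 1/2 ≤ |(⟪μ₁, x⟫ : ℝ)|} + P {x | 1/2 ≤ |(⟪μ₂, x⟫ : ℝ)|}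
  rw [Pclean, Measure.map_apply hmap hS, Qclean, Measure.smul_apply, Measure.finsetSum_apply]
  have key : ∀ k : Fin 4, Measure.map (fun z => (k, ms μ₁ μ₂ k + z)) P
      ((fun p : Fin 4 × EuclideanSpace ℝ (Fin d) => (p.2, ls p.1)) ⁻¹'
        {p : EuclideanSpace ℝ (Fin d) × ℝ |
            Real.sign (|⟪μ₁, p.1⟫| - |⟪μ₂, p.1⟫|) ≠ p.2}) ≤ B := by
    intro k
    rw [Measure.map_apply (by fun_prop) (hmap hS)]
    refine le_trans (measure_mono ?_) (measure_union_le _ _)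
    intro z hz
    by_contra hcon
    simp only [Set.mem_union, Set.mem_ofPred_eq, not_or, not_le] at hcon
    obtain ⟨ha, hb⟩ := hcon
    apply hz
    rw [abs_lt] at ha hb
    fin_cases k
    · simp only [ms, ls, inner_add_right, Fin.zero_eta, Matrix.cons_val_zero, n1, h21]
      apply Real.sign_of_pos
      have : |0 + (⟪μ₂, z⟫ : ℝ)| < 1/2 := by rw [abs_lt]; constructor <;> linarith
      have := le_abs_self (1 + (⟪μ₁, z⟫ : ℝ))
      linarith
    · simp only [ms, ls, inner_add_right, inner_neg_right, neg_zero, zero_add, Fin.mk_one, Matrix.cons_val_one,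
        Matrix.cons_val_zero, n1, h21]
      apply Real.sign_of_pos
      have : |(⟪μ₂, z⟫ : ℝ)| < 1/2 := by rw [abs_lt]; constructor <;> linarith
      have := neg_le_abs (-(1:ℝ) + (⟪μ₁, z⟫ : ℝ))
      linarith
    · simp only [ms, ls, inner_add_right, Fin.reduceFinMk, Matrix.cons_val, n2, h12]
      apply Real.sign_of_neg
      have : |0 + (⟪μ₁, z⟫ : ℝ)| < 1/2 := by rw [abs_lt]; constructor <;> linarith
      have := le_abs_self (1 + (⟪μ₂, z⟫ : ℝ))
      linarith
    · simp only [ms, ls, inner_add_right, inner_neg_right, neg_zero, zero_add, Fin.reduceFinMk, Matrix.cons_val,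
        n2, h12]
      apply Real.sign_of_neg
      have : |(⟪μ₁, z⟫ : ℝ)| < 1/2 := by rw [abs_lt]; constructor <;> linarith
      have := neg_le_abs (-(1:ℝ) + (⟪μ₂, z⟫ : ℝ))
      linarith
  calc _ ≤ (4 : ℝ≥0∞)⁻¹ • ∑ k : Fin 4, B := by
        rw [smul_eq_mul, smul_eq_mul]
        exact mul_le_mul_right (Finset.sum_le_sum fun k _ => key k) _
    _ = B := by
        simp only [Finset.sum_const, Finset.card_univ, Fintype.card_fin, smul_eq_mul, nsmul_eq_mul]
        rw [← mul_assoc]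
        push_cast
        rw [ENNReal.inv_mul_cancel (by norm_num) (by norm_num), one_mul]

/-- In the noiseless setting `η = 0`, under Assumptions (A1)-(A3) (in particular
`σ² ≤ 1/(C²d)` and `d ≥ C log²(n/δ)` for sufficiently large absolute `C`), the classifier
`x ↦ sgn(ν(x))` with `ν(x) = |⟨μ₁,x⟩| − |⟨μ₂,x⟩|` satisfies
`P̃(sgn(ν(x)) ≠ ỹ) ≤ C'·√(log(1/δ)/n)` for an absolute constant `C' > 0`. -/
theorem statement13 :
    ∃ C' : ℝ, 0 < C' ∧
    ∃ Cmin : ℝ, 1 < Cmin ∧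
    ∀ C : ℝ, Cmin ≤ C →
    ∀ (d m n : ℕ) (δ σ : ℝ)
      (μ₁ μ₂ : EuclideanSpace ℝ (Fin d))
      (Pclust : Measure (EuclideanSpace ℝ (Fin d))),
      1 ≤ m → 1 ≤ n → 0 < σ →
      δ ∈ Set.Ioo (0 : ℝ) (1/2) →
      ‖μ₁‖ = 1 → ‖μ₂‖ = 1 → ⟪μ₁, μ₂⟫ = 0 →
      IsLogConcaveIso σ Pclust →
      -- Assumptions (A1)-(A3)
      C * max ((Real.log (n/δ))^2) (Real.log (m/δ)) ≤ (d : ℝ) →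
      σ^2 ≤ 1/(C^2 * d) →
      C * Real.log (m/δ) ≤ (n : ℝ) →
      Pclean μ₁ μ₂ Pclust
          {p : EuclideanSpace ℝ (Fin d) × ℝ |
            Real.sign (|⟪μ₁, p.1⟫| - |⟪μ₂, p.1⟫|) ≠ p.2} ≤
        ENNReal.ofReal (C' * Real.sqrt (Real.log (1/δ) / n)) := by
  refine ⟨4, by norm_num, 14, by norm_num, ?_⟩
  intro C hC d m n δ σ μ₁ μ₂ P hm hn hσ hδ h1 h2 h12 hP hA1 hA2 hA3
  obtain ⟨hδ0, hδ2⟩ := hδ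
  have hn1 : (1:ℝ) ≤ n := by exact_mod_cast hn
  have hl2 : (2/3 : ℝ) < Real.log 2 := by have := Real.log_two_gt_d9; linarith
  set L := Real.log (n/δ) with hL
  have hLge : Real.log 2 ≤ L := by
    apply Real.log_le_log (by norm_num)
    rw [le_div_iff₀ hδ0]; linarith
  have hdL : C * L^2 ≤ d :=
    (mul_le_mul_of_nonneg_left (le_max_left _ _) (by linarith)).trans hA1
  have hd0 : (0:ℝ) < d := by
    refine lt_of_lt_of_le ?_ hdL
    have : 0 < L := by linarith
    have : 0 < C := by linarith
    positivity
  have hσL : 14 * L * σ ≤ 1 := by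
    have hC0 : 0 < C := by linarith
    have a1 : σ^2 * (C^2 * d) ≤ 1 := by
      rwa [le_div_iff₀ (by positivity)] at hA2
    have a2 : (14 * L * σ)^2 ≤ 1 := by
      have b1 : (14:ℝ)^2 ≤ C^2 := pow_le_pow_left₀ (by norm_num) hC 2
      have b2 : L^2 ≤ d := by nlinarith [sq_nonneg L]
      have b3 : (14:ℝ)^2 * L^2 ≤ C^2 * d := mul_le_mul b1 b2 (sq_nonneg _) (sq_nonneg _)
      nlinarith [mul_le_mul_of_nonneg_left b3 (sq_nonneg σ)]
    exact (abs_le_one_iff_mul_self_le_one.2 (by linarith [sq (14 * L * σ)]) |> abs_le.1).2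
  set k := ⌈L⌉₊ with hk
  have hkL : L ≤ k := Nat.le_ceil L
  have hkL' : (k:ℝ) < L + 1 := Nat.ceil_lt_add_one (by linarith)
  have hkσ : (4 * (k:ℝ) - 2) * σ ≤ 1/2 := by
    have : (4 * (k:ℝ) - 2) ≤ 7 * L := by linarith
    have := mul_le_mul_of_nonneg_right this hσ.le
    linarith
  have h3 : (1/3 : ℝ)^k ≤ δ / n := by
    have e1 : δ / n = Real.exp (-L) := by
      rw [Real.exp_neg, hL, Real.exp_log (by positivity), inv_div]
    have e2 : (1/3 : ℝ) ≤ Real.exp (-1) := by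
      rw [Real.exp_neg, one_div]
      apply inv_anti₀ (Real.exp_pos _)
      have := Real.exp_one_lt_d9; linarith
    rw [e1]
    calc (1/3 : ℝ)^k ≤ (Real.exp (-1))^k := pow_le_pow_left₀ (by norm_num) e2 k
      _ = Real.exp (-k) := by rw [← Real.exp_nat_mul]; congr 1; ring
      _ ≤ _ := Real.exp_le_exp.2 (by linarith)
  refine (Pclean_le h1 h2 h12).trans ?_
  refine (add_le_add (abs_tail hσ hP μ₁ h1 k hkσ) (abs_tail hσ hP μ₂ h2 k hkσ)).trans ?_
  rw [← ENNReal.ofReal_add (by positivity) (by positivity)]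
  apply ENNReal.ofReal_le_ofReal
  have hfin : δ / n ≤ Real.sqrt (Real.log (1/δ) / n) := by
    apply Real.le_sqrt_of_sq_le
    have hlog : 1/4 ≤ Real.log (1/δ) := by
      have : Real.log 2 ≤ Real.log (1/δ) := by
        apply Real.log_le_log (by norm_num)
        rw [le_div_iff₀ hδ0]; linarith
      linarith
    rw [div_pow]
    rw [div_le_div_iff₀ (by positivity) (by positivity)]
    have c1 : δ^2 ≤ 1/4 := by nlinarith
    have c2 : (n:ℝ) ≤ n^2 := by nlinarith
    exact mul_le_mul (c1.trans hlog) c2 (by positivity) (by linarith)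
  linarith
end
end
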